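/- (Potts–Ising ground state duality.) Let M ≥ 1, N ≥ 1, λ ≥ 0, and let d : Fin N → ZMod M → ZMod M → ℝ be additive, i.e., d i j l + d i l k = d i j k for all i, j, l, k. Then the Potts model with nonuniform onsite field d and nearest-neighbor coupling λ has the same ground state energy as the dual domain-wall (Ising) model with couplings J_{pq} = max_{i ∈ Fin N} d i p q: the minimum over all configurations σ : ZMod M → Fin N of the Potts energy H(σ) equals the minimum over all finsets W ⊆ ZMod M of the domain-wall energy E(W). -/

import Mathlib

/-- The wall set of a spin configuration `σ` on the cycle `ZMod M`:
the set of sites `j` where the spin changes between `j - 1` and `j`. -/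
def wallSet {M N : ℕ} [NeZero M] (σ : ZMod M → Fin N) : Finset (ZMod M) :=
  Finset.univ.filter fun j => σ (j - 1) ≠ σ j

/-- The cyclic successor of `p` within a finset `W ⊆ ZMod M`: `p + k` where
`k` is the least positive natural number with `p + k ∈ W` (such a `k ≤ M`
exists whenever `W` is nonempty; otherwise we return `p` itself). -/
noncomputable def nextWall {M : ℕ} (W : Finset (ZMod M)) (p : ZMod M) : ZMod M :=
  open Classical in
  if h : ∃ k : ℕ, 0 < k ∧ p + (k : ZMod M) ∈ W then p + ((Nat.find h : ℕ) : ZMod M)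
  else p

/-- The Potts energy of a configuration `σ : ZMod M → Fin N` with onsite
field `d` and nearest-neighbor coupling `lam`:
`H(σ) = -(∑ j, d (σ j) j (j+1)) - lam * #{j : σ j = σ (j+1)}`. -/
def pottsEnergy {M N : ℕ} [NeZero M] (lam : ℝ)
    (d : Fin N → ZMod M → ZMod M → ℝ) (σ : ZMod M → Fin N) : ℝ :=
  -(∑ j : ZMod M, d (σ j) j (j + 1))
    - lam * ((Finset.univ.filter fun j : ZMod M => σ j = σ (j + 1)).card : ℝ)

/-- The domain-wall (Ising) energy of a finset `W ⊆ ZMod M` of wall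
positions, with couplings `J p q = max_i d i p q`:
`E(W) = -(∑ p ∈ W, max_i d i p (next_W p)) - lam * (M - #W)` for nonempty `W`,
and `E(∅) = -lam * M`. -/
noncomputable def isingEnergy {M N : ℕ} [NeZero M] [NeZero N] (lam : ℝ)
    (d : Fin N → ZMod M → ZMod M → ℝ) (W : Finset (ZMod M)) : ℝ :=
  if W.Nonempty then
    -(∑ p ∈ W, Finset.univ.sup' Finset.univ_nonempty
        fun i : Fin N => d i p (nextWall W p))
      - lam * ((M - W.card : ℕ) : ℝ)
  else -lam * (M : ℝ)

/-- In a nonempty `W`, the cyclic successor is reached after a least positive number of steps. -/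
lemma exists_nextWall_eq {M : ℕ} [NeZero M] {W : Finset (ZMod M)} (hW : W.Nonempty)
    (p : ZMod M) :
    ∃ k : ℕ, 0 < k ∧ p + (k : ZMod M) ∈ W ∧ nextWall W p = p + (k : ZMod M) ∧
      ∀ m : ℕ, 0 < m → m < k → p + (m : ZMod M) ∉ W := by
  classical
  obtain ⟨w, hw⟩ := hW
  have h : ∃ k : ℕ, 0 < k ∧ p + (k : ZMod M) ∈ W :=
    ⟨(w - p).val + M, by have := NeZero.pos M; omega, by simpa using hw⟩
  refine ⟨Nat.find h, (Nat.find_spec h).1, (Nat.find_spec h).2, ?_, ?_⟩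
  · unfold nextWall
    rw [dif_pos h]
  · intro m hm hlt hmem
    exact Nat.find_min h hlt ⟨hm, hmem⟩

lemma nextWall_injOn {M : ℕ} [NeZero M] (W : Finset (ZMod M)) :
    Set.InjOn (nextWall W) W := by
  intro p hp q hq hpq
  obtain ⟨k, hk, -, hpk, hkmin⟩ := exists_nextWall_eq ⟨p, hp⟩ p
  obtain ⟨l, hl, -, hql, hlmin⟩ := exists_nextWall_eq ⟨p, hp⟩ q
  rw [hpk, hql] at hpq
  rcases lt_trichotomy k l with h | h | h
  · refine absurd hp ?_
    have := hlmin (l - k) (by omega) (by omega)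
    rwa [Nat.cast_sub h.le, add_sub, ← hpq, add_sub_cancel_right] at this
  · subst h
    exact add_right_cancel hpq
  · refine absurd hq ?_
    have := hkmin (k - l) (by omega) (by omega)
    rwa [Nat.cast_sub h.le, add_sub, hpq, add_sub_cancel_right] at this

/-- A configuration that only changes at sites of `W` is constant up to the next wall. -/
lemma apply_nextWall_sub_one {M N : ℕ} [NeZero M] {W : Finset (ZMod M)} (hW : W.Nonempty)
    {σ : ZMod M → Fin N} (hσ : ∀ j ∉ W, σ (j - 1) = σ j) (p : ZMod M) :
    σ (nextWall W p - 1) = σ p := by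
  obtain ⟨k, hk, -, hpk, hkmin⟩ := exists_nextWall_eq hW p
  have hconst : ∀ m : ℕ, m < k → σ (p + (m : ZMod M)) = σ p := by
    intro m
    induction m with
    | zero => simp
    | succ m ih =>
      intro hm
      rw [← ih (by omega), ← hσ _ (hkmin (m + 1) (by omega) hm)]
      congr 1
      push_cast
      ring
  rw [hpk, ← hconst (k - 1) (by omega), Nat.cast_sub hk, Nat.cast_one, add_sub]

/-- The onsite field of a configuration that only changes at sites of `W` is a sum over `W`. -/
lemma sum_field_eq_sum_walls {M N : ℕ} [NeZero M] {d : Fin N → ZMod M → ZMod M → ℝ}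
    (hadd : ∀ (i : Fin N) (j l k : ZMod M), d i j l + d i l k = d i j k)
    {W : Finset (ZMod M)} (hW : W.Nonempty)
    {σ : ZMod M → Fin N} (hσ : ∀ j ∉ W, σ (j - 1) = σ j) :
    ∑ j, d (σ j) j (j + 1) = ∑ p ∈ W, d (σ p) p (nextWall W p) := by
  have hd : ∀ i j k, d i j k = d i 0 k - d i 0 j := fun i j k => by
    linarith [hadd i 0 j k]
  have hmaps : ∀ p ∈ W, nextWall W p ∈ W := fun p _ => by
    obtain ⟨k, -, hmem, hpk, -⟩ := exists_nextWall_eq hW p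
    rwa [hpk]
  have hshift : ∑ j, d (σ j) 0 (j + 1) = ∑ j, d (σ (j - 1)) 0 j :=
    Fintype.sum_equiv (Equiv.addRight 1) _ _ fun j => by simp
  have hnext : ∑ p ∈ W, d (σ p) 0 (nextWall W p) = ∑ p ∈ W, d (σ (p - 1)) 0 p :=
    Finset.sum_bij (fun p _ => nextWall W p) hmaps
      (fun _ hp _ hq h => nextWall_injOn W hp hq h)
      (fun q hq => by simpa using
        Finset.surjOn_of_injOn_of_card_le _ hmaps (nextWall_injOn W) le_rfl hq)
      (fun p _ => by rw [apply_nextWall_sub_one hW hσ])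
  calc ∑ j, d (σ j) j (j + 1)
      = ∑ j, (d (σ (j - 1)) 0 j - d (σ j) 0 j) := by
        rw [Finset.sum_sub_distrib, ← hshift, ← Finset.sum_sub_distrib]
        exact Finset.sum_congr rfl fun j _ => hd _ _ _
    _ = ∑ p ∈ W, (d (σ (p - 1)) 0 p - d (σ p) 0 p) :=
        (Finset.sum_subset (Finset.subset_univ W) fun j _ hj => by
          rw [hσ j hj, sub_self]).symm
    _ = ∑ p ∈ W, d (σ p) p (nextWall W p) := by
        rw [Finset.sum_sub_distrib, ← hnext, ← Finset.sum_sub_distrib]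
        exact Finset.sum_congr rfl fun p _ => (hd _ _ _).symm

lemma card_filter_eq_succ {M N : ℕ} [NeZero M] (σ : ZMod M → Fin N) :
    (Finset.univ.filter fun j : ZMod M => σ j = σ (j + 1)).card = M - (wallSet σ).card := by
  have hcompl : (wallSet σ)ᶜ = Finset.univ.filter fun j => σ (j - 1) = σ j := by
    ext j
    simp [wallSet]
  have hM : M - (wallSet σ).card = (wallSet σ)ᶜ.card := by
    rw [Finset.card_compl, ZMod.card]
  rw [hM, hcompl]
  exact Finset.card_equiv (Equiv.addRight 1) fun j => by simp

lemma apply_sub_one_of_notMem_wallSet {M N : ℕ} [NeZero M] {σ : ZMod M → Fin N} {j : ZMod M}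
    (hj : j ∉ wallSet σ) : σ (j - 1) = σ j := by
  simpa [wallSet] using hj

lemma pottsEnergy_const {M N : ℕ} [NeZero M] (lam : ℝ) {d : Fin N → ZMod M → ZMod M → ℝ}
    (hadd : ∀ (i : Fin N) (j l k : ZMod M), d i j l + d i l k = d i j k) (i : Fin N) :
    pottsEnergy lam d (fun _ => i) = -lam * (M : ℝ) := by
  have hsum := sum_field_eq_sum_walls hadd (σ := fun _ => i) (W := {0}) (by simp) (by simp)
  have hnext : nextWall {0} (0 : ZMod M) = 0 := by
    obtain ⟨k, -, hmem, hk, -⟩ :=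
      exists_nextWall_eq (Finset.singleton_nonempty (0 : ZMod M)) 0
    rw [hk]
    exact Finset.mem_singleton.1 hmem
  rw [Finset.sum_singleton, hnext] at hsum
  have hzero : d i 0 0 = 0 := by linarith [hadd i 0 0 0]
  simp [pottsEnergy, hsum, hzero, ZMod.card]

lemma isingEnergy_wallSet_le {M N : ℕ} [NeZero M] [NeZero N] (lam : ℝ)
    {d : Fin N → ZMod M → ZMod M → ℝ}
    (hadd : ∀ (i : Fin N) (j l k : ZMod M), d i j l + d i l k = d i j k)
    (σ : ZMod M → Fin N) :
    isingEnergy lam d (wallSet σ) ≤ pottsEnergy lam d σ := by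
  rcases (wallSet σ).eq_empty_or_nonempty with hW | hW
  · have hconst : ∀ m : ℕ, σ (m : ZMod M) = σ 0 := by
      intro m
      induction m with
      | zero => simp
      | succ m ih =>
        rw [← ih, ← apply_sub_one_of_notMem_wallSet (σ := σ) (j := ((m + 1 : ℕ) : ZMod M))
          (by simp [hW])]
        simp
    have hσ : σ = fun _ => σ 0 := by
      funext j
      rw [← hconst j.val, ZMod.natCast_zmod_val]
    rw [hW, hσ, pottsEnergy_const lam hadd]
    simp [isingEnergy]
  · rw [isingEnergy, if_pos hW, pottsEnergy, card_filter_eq_succ,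
      sum_field_eq_sum_walls hadd hW fun _ => apply_sub_one_of_notMem_wallSet]
    gcongr with p
    exact Finset.le_sup' (fun i => d i p (nextWall (wallSet σ) p)) (Finset.mem_univ (σ p))

/-- Labels prescribed on a nonempty `W` extend to a configuration that only changes on `W`. -/
lemma exists_config_extending {M N : ℕ} [NeZero M] {W : Finset (ZMod M)} (hW : W.Nonempty)
    (c : ZMod M → Fin N) :
    ∃ σ : ZMod M → Fin N, (∀ p ∈ W, σ p = c p) ∧ ∀ j ∉ W, σ (j - 1) = σ j := by
  classical
  obtain ⟨w, hw⟩ := hW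
  have h : ∀ j : ZMod M, ∃ k : ℕ, j - (k : ZMod M) ∈ W := fun j =>
    ⟨(j - w).val, by simpa using hw⟩
  refine ⟨fun j => c (j - (Nat.find (h j) : ZMod M)), fun p hp => ?_, fun j hj => ?_⟩
  · have hzero : Nat.find (h p) = 0 := (Nat.find_eq_zero _).2 (by simpa using hp)
    simp [hzero]
  · have hstep : ∀ n : ℕ, j - ((n + 1 : ℕ) : ZMod M) = j - 1 - (n : ZMod M) := fun n => by
      push_cast
      ring
    have hfind : Nat.find (h j) = Nat.find (h (j - 1)) + 1 := by
      rw [Nat.find_eq_iff]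
      refine ⟨by rw [hstep]; exact Nat.find_spec (h (j - 1)), fun n hn => ?_⟩
      cases n with
      | zero => simpa using hj
      | succ n =>
        rw [hstep]
        exact Nat.find_min (h (j - 1)) (by omega)
    simp only [hfind, hstep]

lemma exists_pottsEnergy_le {M N : ℕ} [NeZero M] [NeZero N] {lam : ℝ} (hlam : 0 ≤ lam)
    {d : Fin N → ZMod M → ZMod M → ℝ}
    (hadd : ∀ (i : Fin N) (j l k : ZMod M), d i j l + d i l k = d i j k)
    (W : Finset (ZMod M)) :
    ∃ σ : ZMod M → Fin N, pottsEnergy lam d σ ≤ isingEnergy lam d W := by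
  rcases W.eq_empty_or_nonempty with rfl | hW
  · exact ⟨fun _ => 0, by simp [pottsEnergy_const lam hadd, isingEnergy]⟩
  · choose c hc using fun p => Finset.exists_mem_eq_sup' Finset.univ_nonempty
      fun i : Fin N => d i p (nextWall W p)
    obtain ⟨σ, hσc, hσ⟩ := exists_config_extending hW c
    have hsub : wallSet σ ⊆ W := fun j hj => by
      by_contra hjW
      exact (Finset.mem_filter.1 hj).2 (hσ j hjW)
    have hsum : ∑ p ∈ W, d (σ p) p (nextWall W p) = ∑ p ∈ W,
        Finset.univ.sup' Finset.univ_nonempty fun i : Fin N => d i p (nextWall W p) :=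
      Finset.sum_congr rfl fun p hp => by rw [hσc p hp, (hc p).2]
    refine ⟨σ, ?_⟩
    rw [isingEnergy, if_pos hW, pottsEnergy, card_filter_eq_succ,
      sum_field_eq_sum_walls hadd hW hσ, hsum]
    gcongr

/-- Potts–Ising ground state duality: For an additive field
`d` and `λ ≥ 0`, the Potts model with nonuniform onsite field `d` and
nearest-neighbor coupling `λ` has the same ground state energy as the dual
domain-wall (Ising) model: the minimum over all configurations
`σ : ZMod M → Fin N` of `H(σ)` equals the minimum over all finsets
`W ⊆ ZMod M` of `E(W)`. -/
theorem potts_ising_ground_state_duality (M N : ℕ) [NeZero M] [NeZero N]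
    (lam : ℝ) (hlam : 0 ≤ lam)
    (d : Fin N → ZMod M → ZMod M → ℝ)
    (hadd : ∀ (i : Fin N) (j l k : ZMod M), d i j l + d i l k = d i j k) :
    Finset.univ.inf' Finset.univ_nonempty
        (fun σ : ZMod M → Fin N => pottsEnergy lam d σ)
      = Finset.univ.inf' Finset.univ_nonempty
          (fun W : Finset (ZMod M) => isingEnergy lam d W) := by
  apply le_antisymm
  · refine Finset.le_inf' _ _ fun W _ => ?_
    obtain ⟨σ, hσ⟩ := exists_pottsEnergy_le hlam hadd W
    exact (Finset.inf'_le _ (Finset.mem_univ σ)).trans hσ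
  · refine Finset.le_inf' _ _ fun σ _ => ?_
    exact (Finset.inf'_le _ (Finset.mem_univ (wallSet σ))).trans
      (isingEnergy_wallSet_le lam hadd σ)
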